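/- arXiv:1803.01066 — 3 statements merged into one kernel-verified Lean document; each statement's English description precedes it below -/
import Mathlib

section
/- Let E and F be finite-dimensional real normed vector spaces, let J : E × F → ℝ be twice continuously differentiable on a neighborhood of (θ†, Δ*(θ†)), and let Δ* : E → F be differentiable on a neighborhood of θ† and twice differentiable at θ†. Suppose that for every θ in a neighborhood of θ†, the partial derivative of J with respect to its second argument vanishes at (θ, Δ*(θ)). Then the function g(θ) := J(θ, Δ*(θ)) is twice differentiable at θ† and its second derivative satisfies D²g(θ†)[u, v] = D²J(θ†, Δ*(θ†))[(u, DΔ*(θ†)u), (v, DΔ*(θ†)v)] for all u, v ∈ E; in particular it does not involve the second derivative of Δ*. -/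
/-- second-order envelope theorem: if the partial derivative of `J` with
respect to its second argument vanishes at `(θ, Δ*(θ))` for all `θ` near `θ†`, then the
value function `g(θ) = J(θ, Δ*(θ))` is twice differentiable at `θ†` and its second
derivative is `D²g(θ†)[u, v] = D²J(θ†, Δ*(θ†))[(u, DΔ*(θ†)u), (v, DΔ*(θ†)v)]`;
in particular it does not involve the second derivative of `Δ*`. -/
theorem envelope_second_order
    {E F : Type*}
    [NormedAddCommGroup E] [NormedSpace ℝ E] [FiniteDimensional ℝ E]
    [NormedAddCommGroup F] [NormedSpace ℝ F] [FiniteDimensional ℝ F]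
    (J : E × F → ℝ) (Δstar : E → F) (θdag : E)
    (hJ : ContDiffAt ℝ 2 J (θdag, Δstar θdag))
    (hΔd : ∀ᶠ θ in nhds θdag, DifferentiableAt ℝ Δstar θ)
    (hΔ2 : DifferentiableAt ℝ (fderiv ℝ Δstar) θdag)
    (hstat : ∀ᶠ θ in nhds θdag, ∀ h : F, fderiv ℝ J (θ, Δstar θ) (0, h) = 0) :
    (∀ᶠ θ in nhds θdag, DifferentiableAt ℝ (fun t => J (t, Δstar t)) θ) ∧
      DifferentiableAt ℝ (fderiv ℝ fun t => J (t, Δstar t)) θdag ∧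
      ∀ u v : E,
        fderiv ℝ (fderiv ℝ fun t => J (t, Δstar t)) θdag u v =
          fderiv ℝ (fderiv ℝ J) (θdag, Δstar θdag)
            (u, fderiv ℝ Δstar θdag u) (v, fderiv ℝ Δstar θdag v) := by
  have hp : ∀ θ, DifferentiableAt ℝ Δstar θ →
      HasFDerivAt (fun t => (t, Δstar t))
        ((ContinuousLinearMap.id ℝ E).prod (fderiv ℝ Δstar θ)) θ :=
    fun θ h => (hasFDerivAt_id θ).prodMk h.hasFDerivAt
  have hp0 := hp θdag hΔd.self_of_nhds
  have hJev : ∀ᶠ z in nhds (θdag, Δstar θdag), DifferentiableAt ℝ J z := by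
    filter_upwards [hJ.eventually (by simp)] with z hz
    exact hz.differentiableAt (by simp)
  have hJp : ∀ᶠ θ in nhds θdag, DifferentiableAt ℝ J (θ, Δstar θ) :=
    hp0.continuousAt.eventually hJev
  have hg : ∀ᶠ θ in nhds θdag, HasFDerivAt (fun t => J (t, Δstar t))
      ((fderiv ℝ J (θ, Δstar θ)).comp
        ((ContinuousLinearMap.id ℝ E).prod (fderiv ℝ Δstar θ))) θ := by
    filter_upwards [hΔd, hJp] with θ h1 h2
    exact HasFDerivAt.comp (f := fun t => (t, Δstar t)) θ h2.hasFDerivAt (hp θ h1)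
  have hDJ : HasFDerivAt (fderiv ℝ J) (fderiv ℝ (fderiv ℝ J) (θdag, Δstar θdag))
      (θdag, Δstar θdag) :=
    ((hJ.fderiv_right (m := 1) (by norm_num)).differentiableAt (by simp)).hasFDerivAt
  have hDJp := HasFDerivAt.comp (f := fun t => (t, Δstar t)) θdag hDJ hp0
  have hDg : HasFDerivAt (fderiv ℝ fun t => J (t, Δstar t)) _ θdag :=
    (((ContinuousLinearMap.compL ℝ E (E × F) ℝ).flip
      (ContinuousLinearMap.inl ℝ E F)).hasFDerivAt.comp θdag hDJp).congr_of_eventuallyEq (by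
      filter_upwards [hg, hstat] with θ h1 h2
      rw [h1.fderiv]
      ext v
      have h3 : ((v, fderiv ℝ Δstar θ v) : E × F) = (v, 0) + (0, fderiv ℝ Δstar θ v) := by simp
      simp only [ContinuousLinearMap.comp_apply, ContinuousLinearMap.prod_apply,
        ContinuousLinearMap.id_apply, Function.comp_apply, ContinuousLinearMap.flip_apply,
        ContinuousLinearMap.compL_apply, ContinuousLinearMap.inl_apply]
      rw [h3, map_add, h2, add_zero])
  refine ⟨hg.mono fun θ h => h.differentiableAt, hDg.differentiableAt, fun u v => ?_⟩
  have hz : ∀ h : F, fderiv ℝ (fderiv ℝ J) (θdag, Δstar θdag)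
      (u, fderiv ℝ Δstar θdag u) (0, h) = 0 := by
    intro h
    have h1 := (ContinuousLinearMap.apply ℝ ℝ ((0, h) : E × F)).hasFDerivAt.comp θdag hDJp
    have h2 := (hasFDerivAt_const (𝕜 := ℝ) (0 : ℝ) θdag).congr_of_eventuallyEq
      (f₁ := (ContinuousLinearMap.apply ℝ ℝ ((0, h) : E × F)) ∘
        (fderiv ℝ J ∘ fun t => (t, Δstar t))) (by
      filter_upwards [hstat] with θ h2
      simpa using h2 h)
    have h3 := DFunLike.congr_fun (h1.unique h2) u
    simpa using h3
  have h3 : ((v, fderiv ℝ Δstar θdag v) : E × F) = (v, 0) + (0, fderiv ℝ Δstar θdag v) := by simp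
  rw [hDg.fderiv, h3, map_add, hz, add_zero]
  simp
end

section
/- Let 𝒢 : ℝ^p → (real M×N matrices), ℱ : ℝ^p → (real N×N matrices), η : ℝ^p → ℝ^M and ε : ℝ^p → ℝ^N all be affine functions of θ. For each fixed Δ ∈ ℝ^N, the function θ ↦ ‖𝒢(θ)Δ + η(θ)‖² − 2⟨Δ, ℱ(θ)Δ − ε(θ)⟩ is convex on ℝ^p. Consequently, if s ⊆ ℝ^p is convex and the function Ĵ(θ) := sup over Δ ∈ ℝ^N of (‖𝒢(θ)Δ + η(θ)‖² − 2⟨Δ, ℱ(θ)Δ − ε(θ)⟩) is finite (bounded above in Δ) for every θ ∈ s, then Ĵ is convex on s. -/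
open Matrix

/-- for affine `𝒢, ℱ, η, ε`, the Lagrangian
`θ ↦ ‖𝒢(θ)Δ + η(θ)‖² − 2⟨Δ, ℱ(θ)Δ − ε(θ)⟩` is convex in `θ` for each fixed `Δ`, and
its (pointwise finite) supremum over `Δ` is convex on any convex set `s` on which it is
finite. -/
theorem lagrangian_relaxation_convex
    (p M N : ℕ)
    (𝒢 : (Fin p → ℝ) → Matrix (Fin M) (Fin N) ℝ)
    (ℱ : (Fin p → ℝ) → Matrix (Fin N) (Fin N) ℝ)
    (η : (Fin p → ℝ) → (Fin M → ℝ))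
    (ε : (Fin p → ℝ) → (Fin N → ℝ))
    (h𝒢 : ∀ (θ₁ θ₂ : Fin p → ℝ) (t : ℝ),
      𝒢 (t • θ₁ + (1 - t) • θ₂) = t • 𝒢 θ₁ + (1 - t) • 𝒢 θ₂)
    (hℱ : ∀ (θ₁ θ₂ : Fin p → ℝ) (t : ℝ),
      ℱ (t • θ₁ + (1 - t) • θ₂) = t • ℱ θ₁ + (1 - t) • ℱ θ₂)
    (hη : ∀ (θ₁ θ₂ : Fin p → ℝ) (t : ℝ),
      η (t • θ₁ + (1 - t) • θ₂) = t • η θ₁ + (1 - t) • η θ₂)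
    (hε : ∀ (θ₁ θ₂ : Fin p → ℝ) (t : ℝ),
      ε (t • θ₁ + (1 - t) • θ₂) = t • ε θ₁ + (1 - t) • ε θ₂)
    (obj : (Fin p → ℝ) → (Fin N → ℝ) → ℝ)
    (hobj : ∀ θ Δ, obj θ Δ =
      (𝒢 θ *ᵥ Δ + η θ) ⬝ᵥ (𝒢 θ *ᵥ Δ + η θ) - 2 * (Δ ⬝ᵥ (ℱ θ *ᵥ Δ - ε θ))) :
    (∀ Δ : Fin N → ℝ, ConvexOn ℝ Set.univ (fun θ => obj θ Δ)) ∧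
      ∀ s : Set (Fin p → ℝ), Convex ℝ s →
        (∀ θ ∈ s, BddAbove (Set.range fun Δ => obj θ Δ)) →
        ConvexOn ℝ s (fun θ => sSup (Set.range fun Δ => obj θ Δ)) := by
  have key : ∀ Δ : Fin N → ℝ, ConvexOn ℝ Set.univ (fun θ => obj θ Δ) := by
    intro Δ
    refine ⟨convex_univ, ?_⟩
    intro x _ y _ a b ha hb hab
    obtain rfl : b = 1 - a := by linarith
    have h1 : 𝒢 (a • x + (1 - a) • y) *ᵥ Δ + η (a • x + (1 - a) • y)
        = a • (𝒢 x *ᵥ Δ + η x) + (1 - a) • (𝒢 y *ᵥ Δ + η y) := by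
      rw [h𝒢, hη, Matrix.add_mulVec, Matrix.smul_mulVec, Matrix.smul_mulVec, smul_add, smul_add]
      abel
    have h2 : ℱ (a • x + (1 - a) • y) *ᵥ Δ - ε (a • x + (1 - a) • y)
        = a • (ℱ x *ᵥ Δ - ε x) + (1 - a) • (ℱ y *ᵥ Δ - ε y) := by
      rw [hℱ, hε, Matrix.add_mulVec, Matrix.smul_mulVec, Matrix.smul_mulVec, smul_sub, smul_sub]
      abel
    simp only [hobj, h1, h2, smul_eq_mul]
    generalize 𝒢 x *ᵥ Δ + η x = u
    generalize 𝒢 y *ᵥ Δ + η y = v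
    have h3 : 0 ≤ (u - v) ⬝ᵥ (u - v) :=
      Finset.sum_nonneg fun i _ => mul_self_nonneg _
    have h4 := mul_nonneg (mul_nonneg ha hb) h3
    simp only [sub_dotProduct, dotProduct_sub, dotProduct_comm v u] at h4
    simp only [add_dotProduct, dotProduct_add, smul_dotProduct, dotProduct_smul, smul_eq_mul,
      dotProduct_comm v u]
    linarith
  refine ⟨key, fun s hs hb => ⟨hs, ?_⟩⟩
  intro x hx y hy a b ha hb' hab
  refine csSup_le (Set.range_nonempty _) ?_
  rintro _ ⟨Δ, rfl⟩
  refine ((key Δ).2 (Set.mem_univ x) (Set.mem_univ y) ha hb' hab).trans ?_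
  exact add_le_add
    (mul_le_mul_of_nonneg_left (le_csSup (hb x hx) (Set.mem_range_self Δ)) ha)
    (mul_le_mul_of_nonneg_left (le_csSup (hb y hy) (Set.mem_range_self Δ)) hb')
end

section
/- Let e : ℝ^n → ℝ^n be continuously differentiable, let P be a real symmetric positive definite n×n matrix and μ > 0, and suppose that for every x ∈ ℝ^n the Jacobian E(x) of e at x satisfies E(x) + E(x)ᵀ − P − μI positive semidefinite. Then e is a bijection of ℝ^n; i.e., for every b ∈ ℝ^n there exists a unique s ∈ ℝ^n with e(s) = b. -/
open Matrix

/-- The Jacobian matrix of a map `ℝ^n → ℝ^n` at `x`. -/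
noncomputable def jacobian {n : ℕ} (e : (Fin n → ℝ) → (Fin n → ℝ)) (x : Fin n → ℝ) :
    Matrix (Fin n) (Fin n) ℝ :=
  LinearMap.toMatrix' (fderiv ℝ e x).toLinearMap

theorem aux_quad {n : ℕ} (e : (Fin n → ℝ) → (Fin n → ℝ))
    (P : Matrix (Fin n) (Fin n) ℝ)
    (hPpd : ∀ v : Fin n → ℝ, v ≠ 0 → 0 < v ⬝ᵥ (P *ᵥ v))
    (μ : ℝ)
    (hE : ∀ x v : Fin n → ℝ,
      0 ≤ v ⬝ᵥ ((jacobian e x + (jacobian e x)ᵀ - P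
        - μ • (1 : Matrix (Fin n) (Fin n) ℝ)) *ᵥ v)) (x v : Fin n → ℝ) :
    μ / 2 * (v ⬝ᵥ v) ≤ v ⬝ᵥ (fderiv ℝ e x v) := by
  have h := hE x v
  have hP : 0 ≤ v ⬝ᵥ (P *ᵥ v) := by
    by_cases hv : v = 0
    · simp [hv]
    · exact (hPpd v hv).le
  have hJ : jacobian e x *ᵥ v = fderiv ℝ e x v := by
    simp only [jacobian, LinearMap.toMatrix'_mulVec]
    rfl
  have hT : v ⬝ᵥ ((jacobian e x)ᵀ *ᵥ v) = v ⬝ᵥ (fderiv ℝ e x v) := by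
    rw [Matrix.mulVec_transpose, dotProduct_comm, ← Matrix.dotProduct_mulVec, hJ]
  simp only [Matrix.sub_mulVec, Matrix.add_mulVec, dotProduct_sub, dotProduct_add, hT, hJ,
    Matrix.smul_mulVec, Matrix.one_mulVec, dotProduct_smul, smul_eq_mul] at h
  linarith

theorem aux_mono {n : ℕ} (e : (Fin n → ℝ) → (Fin n → ℝ)) (he : ContDiff ℝ 1 e) (c : ℝ)
    (h : ∀ x v : Fin n → ℝ, c * (v ⬝ᵥ v) ≤ v ⬝ᵥ (fderiv ℝ e x v)) (x y : Fin n → ℝ) :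
    c * ((x - y) ⬝ᵥ (x - y)) ≤ (x - y) ⬝ᵥ (e x - e y) := by
  set v := x - y with hv
  have hd : ∀ t : ℝ, HasDerivAt (fun t : ℝ => v ⬝ᵥ e (y + t • v) - c * (v ⬝ᵥ v) * t)
      (v ⬝ᵥ (fderiv ℝ e (y + t • v) v) - c * (v ⬝ᵥ v)) t := by
    intro t
    have h1 : HasDerivAt (fun t : ℝ => y + t • v) v t := by
      simpa using ((hasDerivAt_id t).smul_const v).const_add y
    have h2 : HasDerivAt (fun t : ℝ => e (y + t • v)) (fderiv ℝ e (y + t • v) v) t :=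
      ((he.differentiable one_ne_zero) (y + t • v)).hasFDerivAt.comp_hasDerivAt t h1
    have h3 : HasDerivAt (fun t : ℝ => v ⬝ᵥ e (y + t • v))
        (v ⬝ᵥ (fderiv ℝ e (y + t • v) v)) t := by
      simp only [dotProduct]
      exact HasDerivAt.fun_sum fun i _ => ((hasDerivAt_pi.1 h2) i).const_mul (v i)
    have h4 : HasDerivAt (fun t : ℝ => c * (v ⬝ᵥ v) * t) (c * (v ⬝ᵥ v)) t := by
      simpa using (hasDerivAt_id t).const_mul (c * (v ⬝ᵥ v))
    exact h3.sub h4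
  have hm := monotone_of_deriv_nonneg (fun t => (hd t).differentiableAt)
    (fun t => by rw [(hd t).deriv]; linarith [h (y + t • v) v])
  have h01 := hm zero_le_one
  have hx : y + v = x := by simp [hv]
  simp only [zero_smul, add_zero, one_smul, hx, mul_zero, mul_one] at h01
  have h5 : v ⬝ᵥ (e x - e y) = v ⬝ᵥ e x - v ⬝ᵥ e y := dotProduct_sub _ _ _
  linarith

theorem aux_le {n : ℕ} (v w : Fin n → ℝ) : v ⬝ᵥ w ≤ n * (‖v‖ * ‖w‖) := by
  have : v ⬝ᵥ w ≤ ∑ _i : Fin n, ‖v‖ * ‖w‖ := by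
    refine Finset.sum_le_sum fun i _ => ?_
    calc v i * w i ≤ ‖v i * w i‖ := Real.le_norm_self _
      _ = ‖v i‖ * ‖w i‖ := norm_mul _ _
      _ ≤ ‖v‖ * ‖w‖ := by gcongr <;> exact norm_le_pi_norm _ i
  simpa using this

theorem aux_ge {n : ℕ} (v : Fin n → ℝ) : ‖v‖ ^ 2 ≤ v ⬝ᵥ v := by
  have h0 : 0 ≤ v ⬝ᵥ v := Finset.sum_nonneg fun i _ => mul_self_nonneg (v i)
  refine (Real.le_sqrt (norm_nonneg _) h0).1 ?_
  refine (pi_norm_le_iff_of_nonneg (Real.sqrt_nonneg _)).2 fun i => ?_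
  refine Real.le_sqrt_of_sq_le ?_
  rw [Real.norm_eq_abs, sq_abs, sq]
  exact Finset.single_le_sum (f := fun i => v i * v i)
    (fun i _ => mul_self_nonneg (v i)) (Finset.mem_univ i)

/-- well-posedness: if `e` is continuously differentiable and its
Jacobian `E(x)` satisfies `E(x) + E(x)ᵀ − P − μI ⪰ 0` for all `x`, with `P` symmetric
positive definite and `μ > 0`, then `e` is a bijection of `ℝ^n`. -/
theorem uniform_monotone_implies_bijective
    (n : ℕ) (e : (Fin n → ℝ) → (Fin n → ℝ)) (he : ContDiff ℝ 1 e)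
    (P : Matrix (Fin n) (Fin n) ℝ) (hPsymm : P.IsSymm)
    (hPpd : ∀ v : Fin n → ℝ, v ≠ 0 → 0 < v ⬝ᵥ (P *ᵥ v))
    (μ : ℝ) (hμ : 0 < μ)
    (hE : ∀ x v : Fin n → ℝ,
      0 ≤ v ⬝ᵥ ((jacobian e x + (jacobian e x)ᵀ - P
        - μ • (1 : Matrix (Fin n) (Fin n) ℝ)) *ᵥ v)) :
    Function.Bijective e := by
  have hq := aux_quad e P hPpd μ hE
  have hm := aux_mono e he (μ / 2) hq
  have hb : ∀ x y, ‖x - y‖ ≤ (2 * n / μ) * ‖e x - e y‖ := by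
    intro x y
    have h1 := hm x y
    have h2 := aux_le (x - y) (e x - e y)
    have h3 := aux_ge (x - y)
    rcases (norm_nonneg (x - y)).eq_or_lt with h0 | h0
    · rw [← h0]; positivity
    · have h4 : μ / 2 * ‖x - y‖ ^ 2 ≤ n * (‖x - y‖ * ‖e x - e y‖) :=
        (mul_le_mul_of_nonneg_left h3 (by positivity)).trans (h1.trans h2)
      have h5 : μ / 2 * ‖x - y‖ ≤ n * ‖e x - e y‖ := by
        refine le_of_mul_le_mul_right ?_ h0
        linarith
      rw [div_mul_eq_mul_div, le_div_iff₀ hμ]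
      linarith
  have ha : AntilipschitzWith (Real.toNNReal (2 * n / μ)) e := by
    refine AntilipschitzWith.of_le_mul_dist fun x y => ?_
    rw [Real.coe_toNNReal _ (by positivity), dist_eq_norm, dist_eq_norm]
    exact hb x y
  refine ⟨ha.injective, ?_⟩
  have hclosed : IsClosed (Set.range e) := by
    have ht := ha.tendsto_cobounded
    rw [Metric.cobounded_eq_cocompact] at ht
    exact (isProperMap_iff_tendsto_cocompact.2 ⟨he.continuous, ht⟩).isClosedMap.isClosed_range
  have hopen : IsOpen (Set.range e) := by
    refine IsOpenMap.isOpen_range (IsOpenMap.of_nhds_le fun x => ?_)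
    have hs : HasStrictFDerivAt e (fderiv ℝ e x) x :=
      he.contDiffAt.hasStrictFDerivAt one_ne_zero
    refine (hs.map_nhds_eq_of_surj ?_).ge
    refine LinearMap.range_eq_top.2 (LinearMap.injective_iff_surjective.1 ?_)
    refine (injective_iff_map_eq_zero _).2 fun v hv => ?_
    have h1 := hq x v
    have hv' : fderiv ℝ e x v = 0 := hv
    rw [hv', dotProduct_zero] at h1
    have h2 := aux_ge v
    have h3 : ‖v‖ ^ 2 ≤ 0 := by nlinarith
    exact norm_eq_zero.1 (pow_eq_zero_iff two_ne_zero |>.1 (le_antisymm h3 (sq_nonneg _)))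
  exact Set.range_eq_univ.1 (IsClopen.eq_univ ⟨hclosed, hopen⟩ (Set.range_nonempty e))
end
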